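/- Let P be an (m,k)-partition of a finite set X and Q an r-subpartition containing at least one block of minimal size n_1, with r_i blocks of size n_i in Q. Let A_Q = {f ∈ Γ(X,P) | range(f) is the union of the blocks of Q}. Then the number of regular elements of Γ(X,P) lying in A_Q equals (r_1!)·S(m_1,r_1)·(n_1!)^{m_1} · ∏_{i=2}^{k} Σ_{p=r_i}^{m_i} [ C(m_i,p)·(r_i!)·S(p,r_i)·(n_i!)^{p} · ( Σ_{j=1}^{i−1} r_j·(n_j!)·S(n_i,n_j) )^{m_i − p} ]. -/

import Mathlib

/-- `B : ι → Set X` is a partition of `X` into nonempty pairwise disjoint blocks. -/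
def IsPartition {X ι : Type*} (B : ι → Set X) : Prop :=
  (∀ i, (B i).Nonempty) ∧ (Pairwise fun i j => Disjoint (B i) (B j)) ∧ (⋃ i, B i) = Set.univ

/-- membership in `T(X,P)`: every block maps into some block. -/
def MapsInto {X ι : Type*} (B : ι → Set X) (f : X → X) : Prop := ∀ i, ∃ j, f '' B i ⊆ B j

/-- membership in `Γ(X,P)`: every block maps onto some block. -/
def MapsOnto {X ι : Type*} (B : ι → Set X) (f : X → X) : Prop := ∀ i, ∃ j, f '' B i = B j

/-- membership in `Σ(X,P)`. -/
def InSigma {X ι : Type*} (B : ι → Set X) (f : X → X) : Prop :=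
  MapsInto B f ∧ ∀ i, (Set.range f ∩ B i).Nonempty

/-- membership in `S(X,P)`, the group of units of `T(X,P)`. -/
def IsUnitT {X ι : Type*} (B : ι → Set X) (f : X → X) : Prop :=
  MapsInto B f ∧ ∃ g, MapsInto B g ∧ f ∘ g = id ∧ g ∘ f = id

/-- Stirling numbers of the second kind. -/
def stirling2 : ℕ → ℕ → ℕ
  | 0, 0 => 1
  | 0, _ + 1 => 0
  | _ + 1, 0 => 0
  | n + 1, k + 1 => (k + 1) * stirling2 n (k + 1) + stirling2 n k


theorem stirling2_eq_zero_of_lt {n k : ℕ} (h : n < k) : stirling2 n k = 0 := by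
  induction n generalizing k with
  | zero => obtain ⟨k, rfl⟩ := Nat.exists_eq_succ_of_ne_zero h.ne'; rfl
  | succ n ih =>
    obtain ⟨k, rfl⟩ := Nat.exists_eq_succ_of_ne_zero (Nat.ne_zero_of_lt h)
    simp [stirling2, ih (Nat.lt_of_succ_lt h), ih (Nat.lt_of_succ_lt_succ h)]

theorem stirling2_self (n : ℕ) : stirling2 n n = 1 := by
  induction n with
  | zero => rfl
  | succ n ih => simp [stirling2, ih, stirling2_eq_zero_of_lt (Nat.lt_succ_self n)]

theorem card_fin_fun_range_eq {X : Type*} [Finite X] (n : ℕ) (S : Set X) :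
    Nat.card {h : Fin n → X // Set.range h = S} = S.ncard.factorial * stirling2 n S.ncard := by
  classical
  have := Fintype.ofFinite X
  induction n generalizing S with
  | zero =>
    rcases S.eq_empty_or_nonempty with rfl | hS
    · simp [stirling2]
    · obtain ⟨k, hk⟩ := Nat.exists_eq_succ_of_ne_zero ((Set.ncard_pos S.toFinite).2 hS).ne'
      rw [hk]
      have : IsEmpty {h : Fin 0 → X // Set.range h = S} :=
        ⟨fun h => hS.ne_empty (by rw [← h.2]; exact Set.range_eq_empty _)⟩
      rw [Nat.card_of_isEmpty]
      simp [stirling2]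
  | succ n ih =>
    have key : Nat.card {h : Fin (n + 1) → X // Set.range h = S} =
        Nat.card (Σ y : S, ({g : Fin n → X // Set.range g = S} ⊕
          {g : Fin n → X // Set.range g = S \ {y.1}})) := by
      have e1 : {h : Fin (n + 1) → X // Set.range h = S} ≃
          Σ y : S, {g : Fin n → X // insert y.1 (Set.range g) = S} :=
        { toFun := fun h => ⟨⟨h.1 0, h.2.subset (Set.mem_range_self 0)⟩, Fin.tail h.1, by
            rw [← Fin.range_cons, Fin.cons_self_tail]; exact h.2⟩
          invFun := fun p => ⟨Fin.cons p.1.1 p.2.1, by rw [Fin.range_cons]; exact p.2.2⟩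
          left_inv := fun h => Subtype.ext (Fin.cons_self_tail _)
          right_inv := fun p => rfl }
      rw [Nat.card_congr e1, Nat.card_sigma, Nat.card_sigma]
      refine Finset.sum_congr rfl fun y _ => ?_
      have hd : Disjoint (fun g : Fin n → X => Set.range g = S)
          (fun g : Fin n → X => Set.range g = S \ {y.1}) := by
        rw [Pi.disjoint_iff]
        intro g
        rw [Prop.disjoint_iff]
        rintro ⟨h1, h2⟩
        exact ((h1.symm.trans h2).subset y.2).2 rfl
      rw [← Nat.card_congr (subtypeOrEquiv _ _ hd)]
      refine Nat.card_congr (Equiv.subtypeEquivRight fun g => ?_)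
      constructor
      · intro h
        by_cases hy : y.1 ∈ Set.range g
        · left; rwa [Set.insert_eq_of_mem hy] at h
        · right; exact (Set.insert_sdiff_self_of_notMem hy).symm.trans (congrArg (· \ {y.1}) h)
      · rintro (h | h)
        · rw [h]; exact Set.insert_eq_of_mem y.2
        · rw [h]; simp
    rw [key, Nat.card_sigma]
    simp only [Nat.card_sum, ih]
    rcases S.eq_empty_or_nonempty with rfl | hS
    · simp [stirling2]
    · obtain ⟨k, hk⟩ := Nat.exists_eq_succ_of_ne_zero ((Set.ncard_pos S.toFinite).2 hS).ne'
      have hk' : ∀ y : S, (S \ {y.1}).ncard = k := fun y => by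
        rw [Set.ncard_sdiff_singleton_of_mem y.2, hk]; rfl
      simp only [hk', hk, Finset.sum_const, Finset.card_univ, ← Nat.card_eq_fintype_card,
        Nat.card_coe_set_eq, smul_eq_mul, stirling2, Nat.succ_eq_add_one, Nat.factorial_succ]
      ring

theorem card_fun_range_eq {α X : Type*} [Finite α] [Finite X] (S : Set X) :
    Nat.card {h : α → X // Set.range h = S} =
      S.ncard.factorial * stirling2 (Nat.card α) S.ncard := by
  rw [← card_fin_fun_range_eq]
  refine Nat.card_congr (((Finite.equivFin α).arrowCongr (Equiv.refl X)).subtypeEquiv fun h => ?_)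
  simp [Equiv.arrowCongr, Set.range_comp]

/-- Weighted count of the maps `α → ι` whose range contains `R`, when the weight is constant
on `R`. -/
theorem sum_covering_prod {α ι : Type*} [Fintype α] [Fintype ι] [DecidableEq α] [DecidableEq ι]
    (w : ι → ℕ) (R : Finset ι) (a : ℕ) (ha : ∀ q ∈ R, w q = a) :
    ∑ φ : α → ι with (∀ q ∈ R, ∃ t, φ t = q), ∏ t, w (φ t) =
      ∑ p ∈ Finset.Icc R.card (Fintype.card α), (Fintype.card α).choose p *
        R.card.factorial * stirling2 p R.card * a ^ p *
          (∑ q ∈ Rᶜ, w q) ^ (Fintype.card α - p) := by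
  have fiber : ∀ T : Finset α,
      ∑ φ : α → ι with ((∀ q ∈ R, ∃ t, φ t = q) ∧ Finset.univ.filter (fun t => φ t ∈ R) = T),
        ∏ t, w (φ t) = R.card.factorial * stirling2 T.card R.card * a ^ T.card *
          (∑ q ∈ Rᶜ, w q) ^ (Fintype.card α - T.card) := by
    intro T
    have h1 : ∑ φ : {t // t ∈ T} → ι with Set.range φ = R, ∏ t, w (φ t) =
        R.card.factorial * stirling2 T.card R.card * a ^ T.card := by
      have := card_fun_range_eq (α := {t // t ∈ T}) (R : Set ι)
      rw [Nat.card_eq_fintype_card, Fintype.card_subtype, Set.ncard_coe_finset,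
        Nat.card_eq_fintype_card, Fintype.card_coe] at this
      rw [← this, ← smul_eq_mul, ← Finset.sum_const]
      refine Finset.sum_congr rfl fun φ hφ => ?_
      rw [Finset.mem_filter] at hφ
      rw [Finset.prod_congr rfl fun t _ => ha (φ t) (by
        rw [← Finset.mem_coe, ← hφ.2]; exact Set.mem_range_self t)]
      simp
    have h2 : ∑ φ ∈ Fintype.piFinset (fun _ : {t // ¬ t ∈ T} => Rᶜ), ∏ t, w (φ t) =
        (∑ q ∈ Rᶜ, w q) ^ (Fintype.card α - T.card) := by
      rw [← Finset.prod_univ_sum (fun _ : {t // ¬ t ∈ T} => Rᶜ) (fun _ q => w q)]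
      simp [Fintype.card_subtype_compl]
    rw [← h1, ← h2, Finset.sum_mul_sum, ← Finset.sum_product']
    refine Finset.sum_equiv (Equiv.piEquivPiSubtypeProd (fun t => t ∈ T) (fun _ => ι)) ?_ ?_
    · intro φ
      simp only [Finset.mem_filter, Finset.mem_univ, true_and, Finset.mem_product,
        Fintype.mem_piFinset, Equiv.piEquivPiSubtypeProd_apply, Finset.mem_compl,
        Finset.ext_iff, Set.ext_iff, Set.mem_range, Finset.mem_coe, Subtype.forall,
        Subtype.exists]
      grind
    · intro φ _
      simp only [Equiv.piEquivPiSubtypeProd_apply]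
      convert (Fintype.prod_subtype_mul_prod_subtype (fun t => t ∈ T) (fun t => w (φ t))).symm
  rw [← Finset.sum_fiberwise _ (fun φ : α → ι => Finset.univ.filter (fun t => φ t ∈ R))]
  simp only [Finset.filter_filter, fiber]
  rw [← Finset.powerset_univ, Finset.sum_powerset_apply_card (fun p => R.card.factorial *
    stirling2 p R.card * a ^ p * (∑ q ∈ Rᶜ, w q) ^ (Fintype.card α - p)), Finset.card_univ]
  symm
  refine Finset.sum_subset_zero_on_sdiff ?_ ?_ ?_
  · intro p hp
    simp only [Finset.mem_Icc, Finset.mem_range] at *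
    lia
  · intro p hp
    simp only [Finset.mem_Icc, Finset.mem_range, Finset.mem_sdiff] at hp
    rw [stirling2_eq_zero_of_lt (by lia)]
    simp
  · intro p _
    rw [smul_eq_mul]
    ring

namespace IsPartition

variable {X ι : Type*} {B : ι → Set X}

theorem eq_of_mem (hP : IsPartition B) {i j : ι} {x : X} (hi : x ∈ B i) (hj : x ∈ B j) :
    i = j := by
  by_contra h
  exact Set.disjoint_left.1 (hP.2.1 h) hi hj

theorem exists_mem (hP : IsPartition B) (x : X) : ∃ i, x ∈ B i :=
  Set.mem_iUnion.1 (hP.2.2 ▸ Set.mem_univ x)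

theorem injective (hP : IsPartition B) : Function.Injective B := fun i j h => by
  obtain ⟨x, hx⟩ := hP.1 i
  exact hP.eq_of_mem hx (h ▸ hx)

/-- Regular elements of `Γ(X,P)` with range the union of the blocks in `Q`, described through the
induced map on blocks. -/
theorem exists_blockMap_iff [Finite X] (hP : IsPartition B) (Q : Finset ι) (f : X → X) :
    (MapsOnto B f ∧ (∃ g, MapsOnto B g ∧ f ∘ g ∘ f = f) ∧ Set.range f = ⋃ p ∈ Q, B p) ↔
      ∃ φ : ι → ι, (∀ q ∈ Q, ∃ c, (B c).ncard = (B q).ncard ∧ φ c = q) ∧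
        ∀ i, φ i ∈ Q ∧ f '' B i = B (φ i) := by
  classical
  constructor
  · rintro ⟨hf, ⟨g, hg, hfg⟩, hrange⟩
    choose φ hφ using hf
    refine ⟨φ, fun q hq => ?_, fun i => ⟨?_, hφ i⟩⟩
    · obtain ⟨x, hx⟩ := hP.1 q
      have hxr : x ∈ Set.range f := hrange ▸ Set.mem_biUnion hq hx
      obtain ⟨y, rfl⟩ := hxr
      obtain ⟨a, ha⟩ := hP.exists_mem y
      have haq : φ a = q := hP.eq_of_mem (hφ a ▸ Set.mem_image_of_mem f ha) hx
      obtain ⟨c, hc⟩ := hg q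
      have hfc : f '' B c = B q := by
        rw [← hc, ← haq, ← hφ a, ← Set.image_comp, ← Set.image_comp, Function.comp_assoc, hfg]
      refine ⟨c, le_antisymm ?_ ?_, hP.injective ((hφ c).symm.trans hfc)⟩
      · rw [← hc]; exact Set.ncard_image_le (Set.toFinite _)
      · rw [← hfc]; exact Set.ncard_image_le (Set.toFinite _)
    · obtain ⟨x, hx⟩ := hP.1 i
      have h1 : f x ∈ ⋃ p ∈ Q, B p := hrange ▸ Set.mem_range_self x
      obtain ⟨q, hq, hxq⟩ := Set.mem_iUnion₂.1 h1
      rwa [hP.eq_of_mem (i := φ i) (hφ i ▸ Set.mem_image_of_mem f hx) hxq]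
  · rintro ⟨φ, hcov, hφ⟩
    refine ⟨fun i => ⟨φ i, (hφ i).2⟩, ?_, ?_⟩
    · choose! c hc hcq using hcov
      choose idx hidx using hP.exists_mem
      have hsec : ∀ x, idx x ∈ Q → ∃ y ∈ B (c (idx x)), f y = x := fun x hx => by
        have : x ∈ f '' B (c (idx x)) := by rw [(hφ _).2, hcq _ hx]; exact hidx x
        exact this
      choose! s hs hfs using hsec
      have hidx_eq : ∀ {x i}, x ∈ B i → idx x = i := fun hx => hP.eq_of_mem (hidx _) hx
      refine ⟨fun x => if idx x ∈ Q then s x else x, fun i => ?_, ?_⟩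
      · by_cases hi : i ∈ Q
        · refine ⟨c i, Set.eq_of_subset_of_ncard_le ?_ ?_ (Set.toFinite _)⟩
          · rintro _ ⟨x, hx, rfl⟩
            obtain rfl := hidx_eq hx
            simpa [hi] using hs x hi
          · rw [Set.InjOn.ncard_image, hc i hi]
            intro x hx y hy hxy
            have hxQ : idx x ∈ Q := by rwa [hidx_eq hx]
            have hyQ : idx y ∈ Q := by rwa [hidx_eq hy]
            simp only [hxQ, hyQ, if_true] at hxy
            rw [← hfs x hxQ, ← hfs y hyQ, hxy]
        · refine ⟨i, ?_⟩
          rw [Set.image_congr (g := id), Set.image_id]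
          intro x hx
          simp [hidx_eq hx, hi]
      · funext x
        obtain ⟨i, hi⟩ := hP.exists_mem x
        have h1 : idx (f x) = φ i := hidx_eq ((hφ i).2 ▸ Set.mem_image_of_mem f hi)
        have h2 : idx (f x) ∈ Q := h1 ▸ (hφ i).1
        simp [h2, hfs]
    · ext x
      simp only [Set.mem_iUnion, Set.mem_range]
      constructor
      · rintro ⟨y, rfl⟩
        obtain ⟨i, hi⟩ := hP.exists_mem y
        exact ⟨φ i, (hφ i).1, (hφ i).2 ▸ Set.mem_image_of_mem f hi⟩
      · rintro ⟨q, hq, hx⟩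
        obtain ⟨c, -, rfl⟩ := hcov q hq
        rw [← (hφ c).2] at hx
        obtain ⟨y, -, rfl⟩ := hx
        exact ⟨y, rfl⟩

theorem card_image_eq [Finite X] [Fintype ι] [DecidableEq ι] (hP : IsPartition B) (Q : Finset ι)
    (φ : ι → ι) :
    Nat.card {f : X → X // ∀ i, φ i ∈ Q ∧ f '' B i = B (φ i)} =
      ∏ i, if φ i ∈ Q then
        (B (φ i)).ncard.factorial * stirling2 (B i).ncard (B (φ i)).ncard else 0 := by
  have hbij : Function.Bijective (fun p : Σ i, B i => (p.2 : X)) := by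
    constructor
    · rintro ⟨i, x, hx⟩ ⟨j, y, hy⟩ h
      obtain rfl : x = y := h
      obtain rfl := hP.eq_of_mem hx hy
      rfl
    · intro x
      obtain ⟨i, hi⟩ := hP.exists_mem x
      exact ⟨⟨i, x, hi⟩, rfl⟩
  let e : (X → X) ≃ (∀ i, B i → X) :=
    ((Equiv.ofBijective _ hbij).symm.arrowCongr (Equiv.refl X)).trans
      (Equiv.piCurry fun _ _ => X)
  have h1 : {f : X → X // ∀ i, φ i ∈ Q ∧ f '' B i = B (φ i)} ≃
      {h : ∀ i, B i → X // ∀ i, φ i ∈ Q ∧ Set.range (h i) = B (φ i)} := by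
    refine e.subtypeEquiv fun f => forall_congr' fun i => and_congr_right fun _ => ?_
    rw [Set.image_eq_range]
    rfl
  rw [Nat.card_congr (h1.trans (Equiv.subtypePiEquivPi
    (p := fun {i} (h : B i → X) => φ i ∈ Q ∧ Set.range h = B (φ i)))), Nat.card_pi]
  refine Finset.prod_congr rfl fun i _ => ?_
  split_ifs with hi
  · simp only [hi, true_and, card_fun_range_eq, Nat.card_coe_set_eq]
  · simp [hi]

theorem card_regular_range_eq [Finite X] [Fintype ι] [DecidableEq ι] (hP : IsPartition B)
    (Q : Finset ι) :
    Nat.card {f : X → X //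
        MapsOnto B f ∧ (∃ g, MapsOnto B g ∧ f ∘ g ∘ f = f) ∧ Set.range f = ⋃ p ∈ Q, B p} =
      ∑ φ : ι → ι with (∀ q ∈ Q, ∃ c, (B c).ncard = (B q).ncard ∧ φ c = q),
        ∏ i, if φ i ∈ Q then
          (B (φ i)).ncard.factorial * stirling2 (B i).ncard (B (φ i)).ncard else 0 := by
  let C : (ι → ι) → Prop := fun φ => ∀ q ∈ Q, ∃ c, (B c).ncard = (B q).ncard ∧ φ c = q
  let e : {f : X → X //
        MapsOnto B f ∧ (∃ g, MapsOnto B g ∧ f ∘ g ∘ f = f) ∧ Set.range f = ⋃ p ∈ Q, B p} ≃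
      Σ φ : {φ // C φ}, {f : X → X // ∀ i, φ.1 i ∈ Q ∧ f '' B i = B (φ.1 i)} :=
    { toFun := fun f =>
        have h := (hP.exists_blockMap_iff Q f.1).1 f.2
        ⟨⟨h.choose, h.choose_spec.1⟩, f.1, h.choose_spec.2⟩
      invFun := fun p => ⟨p.2.1, (hP.exists_blockMap_iff Q p.2.1).2 ⟨p.1.1, p.1.2, p.2.2⟩⟩
      left_inv := fun f => rfl
      right_inv := by
        rintro ⟨⟨φ, hφ⟩, f, hf⟩
        have h := (hP.exists_blockMap_iff Q f).1 ((hP.exists_blockMap_iff Q f).2 ⟨φ, hφ, hf⟩)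
        obtain ⟨ψ, hψ⟩ : ∃ ψ, ψ = h.choose := ⟨_, rfl⟩
        have hψφ : ψ = φ := by
          funext i
          rw [hψ]
          exact hP.injective ((h.choose_spec.2 i).2.symm.trans (hf i).2)
        subst hψφ
        subst hψ
        rfl }
  classical
  rw [Nat.card_congr e, Nat.card_sigma]
  rw [Finset.sum_congr rfl fun φ _ => hP.card_image_eq Q φ.1]
  exact (Finset.sum_subtype (p := C) _ (fun φ => by simp [C]) (fun φ => ∏ i, if φ i ∈ Q then
    (B (φ i)).ncard.factorial * stirling2 (B i).ncard (B (φ i)).ncard else 0)).symm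

end IsPartition

/-- The number of regular elements of Γ(X,P) whose range is the union of the blocks of a
fixed r-subpartition Q (containing a block of the minimal size). -/
theorem card_regular_A_Q {X : Type*} [Finite X] {k : ℕ} [NeZero k] (n mcnt : Fin k → ℕ)
    (hmono : StrictMono n)
    (B : (Σ i : Fin k, Fin (mcnt i)) → Set X) (hP : IsPartition B)
    (hsize : ∀ i t, Nat.card (B ⟨i, t⟩) = n i)
    (Q : Finset (Σ i : Fin k, Fin (mcnt i))) (r : Fin k → ℕ)
    (hr : ∀ i, (Q.filter fun p => p.1 = i).card = r i)
    (hr1 : 1 ≤ r 0) :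
    Nat.card {f : X → X //
        MapsOnto B f ∧ (∃ g, MapsOnto B g ∧ f ∘ g ∘ f = f) ∧
          Set.range f = ⋃ p ∈ Q, B p} =
      (r 0).factorial * stirling2 (mcnt 0) (r 0) * (n 0).factorial ^ mcnt 0 *
        ∏ i ∈ Finset.Ioi (0 : Fin k),
          ∑ p ∈ Finset.Icc (r i) (mcnt i),
            (mcnt i).choose p * (r i).factorial * stirling2 p (r i) *
              (n i).factorial ^ p *
              (∑ j ∈ Finset.Iio i, r j * (n j).factorial * stirling2 (n i) (n j)) ^
                (mcnt i - p) := by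
  classical
  have hncard : ∀ c, (B c).ncard = n c.1 := fun c => hsize c.1 c.2
  let w : Fin k → (Σ i : Fin k, Fin (mcnt i)) → ℕ := fun i q =>
    if q ∈ Q then (n q.1).factorial * stirling2 (n i) (n q.1) else 0
  let R : Fin k → Finset (Σ i : Fin k, Fin (mcnt i)) := fun i => Q.filter fun p => p.1 = i
  have hfactor : ∑ φ : (Σ i : Fin k, Fin (mcnt i)) → (Σ i : Fin k, Fin (mcnt i)) with
      (∀ q ∈ Q, ∃ c, (B c).ncard = (B q).ncard ∧ φ c = q), ∏ c, w c.1 (φ c) =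
      ∏ i, ∑ φ : Fin (mcnt i) → (Σ i : Fin k, Fin (mcnt i)) with (∀ q ∈ R i, ∃ t, φ t = q),
        ∏ t, w i (φ t) := by
    rw [Finset.prod_univ_sum]
    refine Finset.sum_equiv (Equiv.piCurry fun _ _ => (Σ i : Fin k, Fin (mcnt i))) ?_ ?_
    · intro φ
      simp only [Finset.mem_filter, Finset.mem_univ, true_and, Fintype.mem_piFinset, hncard,
        hmono.injective.eq_iff, R]
      constructor
      · rintro h i q ⟨hq, rfl⟩
        obtain ⟨⟨j, t⟩, rfl, hc⟩ := h q hq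
        exact ⟨t, hc⟩
      · intro h q hq
        obtain ⟨t, ht⟩ := h q.1 q ⟨hq, rfl⟩
        exact ⟨⟨q.1, t⟩, rfl, ht⟩
    · intro φ _
      rw [Fintype.prod_sigma]
      rfl
  have hlower : ∀ i, ∑ q ∈ (R i)ᶜ, w i q =
      ∑ j ∈ Finset.Iio i, r j * (n j).factorial * stirling2 (n i) (n j) := by
    intro i
    have h1 : ∑ q ∈ (R i)ᶜ, w i q = ∑ q ∈ Q with q.1 < i,
        (n q.1).factorial * stirling2 (n i) (n q.1) := by
      rw [← Finset.sum_filter_ne_zero]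
      rw [← Finset.sum_filter_ne_zero (s := Q.filter _)]
      refine Finset.sum_congr ?_ ?_
      · ext q
        simp only [Finset.mem_filter, Finset.mem_compl, R, w]
        by_cases hq : q ∈ Q
        · rcases lt_trichotomy q.1 i with h | h | h
          · simp [hq, h, h.ne]
          · simp [hq, h]
          · simp [hq, h.not_gt, stirling2_eq_zero_of_lt (hmono h)]
        · simp [hq]
      · intro q hq
        simp only [Finset.mem_filter] at hq
        simp [w, hq.1.1]
    rw [h1, ← Finset.sum_fiberwise_of_maps_to (g := Sigma.fst) (t := Finset.Iio i)
      (fun q hq => Finset.mem_Iio.2 (Finset.mem_filter.1 hq).2)]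
    refine Finset.sum_congr rfl fun j hj => ?_
    rw [Finset.mem_Iio] at hj
    have h2 : ((Q.filter fun q => q.1 < i).filter fun q => q.1 = j) =
        Q.filter fun q => q.1 = j := by
      rw [Finset.filter_filter]
      refine Finset.filter_congr fun q _ => ?_
      constructor
      · exact And.right
      · rintro rfl
        exact ⟨hj, rfl⟩
    rw [h2, Finset.sum_congr rfl (g := fun _ => (n j).factorial * stirling2 (n i) (n j))
      (fun q hq => by rw [(Finset.mem_filter.1 hq).2]), Finset.sum_const, hr, smul_eq_mul,
      mul_assoc]
  have hlevel : ∀ i, ∑ φ : Fin (mcnt i) → (Σ i : Fin k, Fin (mcnt i)) with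
      (∀ q ∈ R i, ∃ t, φ t = q), ∏ t, w i (φ t) =
      ∑ p ∈ Finset.Icc (r i) (mcnt i), (mcnt i).choose p * (r i).factorial * stirling2 p (r i) *
        (n i).factorial ^ p *
          (∑ j ∈ Finset.Iio i, r j * (n j).factorial * stirling2 (n i) (n j)) ^ (mcnt i - p) := by
    intro i
    have hconst : ∀ q ∈ R i, w i q = (n i).factorial := by
      intro q hq
      obtain ⟨hqQ, rfl⟩ := Finset.mem_filter.1 hq
      simp [w, hqQ, stirling2_self]
    have hcover := sum_covering_prod (α := Fin (mcnt i)) (w i) (R i) (n i).factorial hconst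
    rw [hlower, hr, Fintype.card_fin] at hcover
    convert hcover
  have hr0 : r 0 ≤ mcnt 0 := by
    rw [← hr 0, ← Fintype.card_fin (mcnt 0), ← Finset.card_univ]
    refine (Finset.card_le_card (t := Finset.univ.map (Function.Embedding.sigmaMk 0)) ?_).trans
      (Finset.card_map _).le
    rintro ⟨j, t⟩ hq
    obtain rfl : j = 0 := (Finset.mem_filter.1 hq).2
    simp
  have hbot : Finset.Iio (0 : Fin k) = ∅ := by
    ext j
    simp
  have hunion : (Finset.univ : Finset (Fin k)) = insert 0 (Finset.Ioi 0) := by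
    ext j
    simp
  rw [hP.card_regular_range_eq]
  simp only [hncard]
  simp only [hncard] at hfactor
  rw [hfactor, hunion, Finset.prod_insert (by simp), Finset.prod_congr rfl fun i _ => hlevel i,
    hlevel 0, Finset.sum_eq_single_of_mem (mcnt 0) (Finset.mem_Icc.2 ⟨hr0, le_rfl⟩)]
  · simp
  · intro p hp hne
    rw [hbot, Finset.sum_empty, zero_pow, mul_zero]
    have := (Finset.mem_Icc.1 hp).2
    lia
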